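/- Suppose the social welfare function Φ satisfies restricted monotonicity and faithfulness. Then for every profile p ∈ R̄^I, ψ(p) ≡ Σ_{i∈I_p} w_i u_i for some w ∈ ℝ^{I_p}. If moreover the utility functions (u_i)_{i∈I_p} are linearly independent, then w can be chosen with w_i > 0 for every i ∈ I_p, and w is unique up to multiplication by a positive factor. -/

import Mathlib

open MeasureTheory

/-- An act: a measurable map from states to outcomes. -/
abbrev Act (Ω O : Type*) [MeasurableSpace Ω] [MeasurableSpace O] : Type _ :=
  {f : Ω → O // Measurable f}

/-- Non-atomicity of a measure relative to an explicit σ-algebra `m'`: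
for every `m'`-measurable set of positive measure there is an `m'`-measurable
subset of strictly smaller positive measure. -/
def NonatomicOn {Ω : Type*} [MeasurableSpace Ω] (π : MeasureTheory.Measure Ω)
    (m' : MeasurableSpace Ω) : Prop :=
  ∀ E : Set Ω, MeasurableSet[m'] E → 0 < π E →
    ∃ F : Set Ω, MeasurableSet[m'] F ∧ F ⊆ E ∧ 0 < π F ∧ π F < π E

section Framework

variable {Ω O I : Type*} [mΩ : MeasurableSpace Ω] [mO : MeasurableSpace O]

/-- A belief: a non-atomic (countably additive) probability measure. -/
def IsBelief (π : Measure Ω) : Prop :=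
  IsProbabilityMeasure π ∧ NonatomicOn π mΩ

/-- A utility function: a bounded measurable function on outcomes. -/
def IsUtility (u : O → ℝ) : Prop :=
  Measurable u ∧ ∃ M : ℝ, ∀ x, |u x| ≤ M

/-- A normalized utility function: measurable with infimum 0 and supremum 1. -/
def NormalizedUtility (u : O → ℝ) : Prop :=
  Measurable u ∧ IsGLB (Set.range u) 0 ∧ IsLUB (Set.range u) 1

/-- Member of `𝒰̄`: normalized or identically zero. -/
def NormalizedUtilityBar (u : O → ℝ) : Prop :=
  NormalizedUtility u ∨ u = 0

/-- Subjective expected utility of an act. -/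
noncomputable def ev (π : Measure Ω) (u : O → ℝ) (f : Act Ω O) : ℝ :=
  ∫ ω, u (f.1 ω) ∂π

/-- Preference relations over acts. -/
abbrev Pref (Ω O : Type*) [MeasurableSpace Ω] [MeasurableSpace O] :=
  Act Ω O → Act Ω O → Prop

/-- `(π, u)` represents `r`: `f ≿ g` iff the expected utility of `f` is at least
that of `g`. -/
def Represents (π : Measure Ω) (u : O → ℝ) (r : Pref Ω O) : Prop :=
  ∀ f g : Act Ω O, r f g ↔ ev π u g ≤ ev π u f

/-- A normalized representation: a belief together with a normalized (or zero)
utility function representing the relation. -/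
def NormRep (π : Measure Ω) (u : O → ℝ) (r : Pref Ω O) : Prop :=
  IsBelief π ∧ NormalizedUtilityBar u ∧ Represents π u r

/-- Membership in `R̄`: the relation maximizes subjective expected utility. -/
def IsSEU (r : Pref Ω O) : Prop :=
  ∃ (π : Measure Ω) (u : O → ℝ), IsBelief π ∧ IsUtility u ∧ Represents π u r

/-- Complete indifference: the relation with empty strict part. -/
def CompletelyIndifferent (r : Pref Ω O) : Prop :=
  ∀ f g : Act Ω O, r f g

/-- `π` is a belief representing `r` (together with some utility function). -/
def RepresentsBelief (π : Measure Ω) (r : Pref Ω O) : Prop :=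
  IsBelief π ∧ ∃ u : O → ℝ, IsUtility u ∧ Represents π u r

/-- A preference profile: every agent's relation is SEU-maximizing. -/
def IsProfile (p : I → Pref Ω O) : Prop := ∀ i, IsSEU (p i)

/-- The completely indifferent relation. -/
def indiffRel : Pref Ω O := fun _ _ => True

open Classical in
/-- `p_{∼i}`: replace agent `i`'s relation by complete indifference. -/
noncomputable def updIndiff (p : I → Pref Ω O) (i : I) : I → Pref Ω O :=
  fun j => if j = i then indiffRel else p j

/-- `p_{∼{i,j}}`. -/
noncomputable def updIndiffPair (p : I → Pref Ω O) (i j : I) : I → Pref Ω O :=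
  updIndiff (updIndiff p i) j

open Classical in
/-- `I_p`: the set of concerned agents. -/
noncomputable def concerned [Fintype I] (p : I → Pref Ω O) : Finset I :=
  Finset.univ.filter fun i => ¬ CompletelyIndifferent (p i)

/-- Equivalence of utility functions: equality up to a positive affine
transformation. -/
def UEquiv (u v : O → ℝ) : Prop :=
  ∃ a : ℝ, 0 < a ∧ ∃ b : ℝ, ∀ x, u x = a * v x + b

/-- The beliefs `(πa i)_{i ∈ J}` are affinely independent. -/
def BeliefsAffIndep (J : Finset I) (πa : I → Measure Ω) : Prop :=
  ∀ c : I → ℝ, (∑ i ∈ J, c i) = 0 →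
    (∀ E : Set Ω, MeasurableSet E → (∑ i ∈ J, c i * (πa i E).toReal) = 0) →
    ∀ i ∈ J, c i = 0

/-- The utility functions `(ua i)_{i ∈ J}` are linearly independent: no
nontrivial linear combination of them is a constant function. -/
def UtilsLinIndep (J : Finset I) (ua : I → O → ℝ) : Prop :=
  ∀ c : I → ℝ, (∃ b : ℝ, ∀ x, (∑ i ∈ J, c i * ua i x) = b) → ∀ i ∈ J, c i = 0

/-- The profile has non-degenerate beliefs: the beliefs of any pair and any
triple of concerned agents are affinely independent. -/
def NonDegenerateBeliefs [Fintype I] (p : I → Pref Ω O) (πa : I → Measure Ω) : Prop :=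
  ∀ J : Finset I, J ⊆ concerned p → (J.card = 2 ∨ J.card = 3) → BeliefsAffIndep J πa

/-- The profile has non-degenerate utilities: the utility functions of any pair
and any triple of concerned agents are linearly independent. -/
def NonDegenerateUtils [Fintype I] (p : I → Pref Ω O) (ua : I → O → ℝ) : Prop :=
  ∀ J : Finset I, J ⊆ concerned p → (J.card = 2 ∨ J.card = 3) → UtilsLinIndep J ua

/-- The belief dimension of the beliefs `(πa i)_{i ∈ J}` is at least `n`. -/
def BeliefDimAtLeast (n : ℕ) (J : Finset I) (πa : I → Measure Ω) : Prop :=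
  ∃ E : Fin n → Set Ω, (∀ k, MeasurableSet (E k)) ∧
    ∀ c : Fin n → ℝ, (∀ i ∈ J, (∑ k, c k * (πa i (E k)).toReal) = 0) → ∀ k, c k = 0

/-- The utility dimension of the utility functions `(ua i)_{i ∈ J}` is at
least `n`. -/
def UtilDimAtLeast (n : ℕ) (J : Finset I) (ua : I → O → ℝ) : Prop :=
  ∃ q : Fin n → Measure O, (∀ k, IsProbabilityMeasure (q k)) ∧
    ∀ c : Fin n → ℝ, (∀ i ∈ J, (∑ k, c k * ∫ x, ua i x ∂(q k)) = 0) → ∀ k, c k = 0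

open Classical in
/-- The expected utility function of an SEU relation (via a choice of a
normalized representation). -/
noncomputable def evOf (r : Pref Ω O) : Act Ω O → ℝ :=
  if h : ∃ π : Measure Ω, ∃ u : O → ℝ, NormRep π u r then
    fun f => ev h.choose h.choose_spec.choose f
  else fun _ => 0

/-- The uniform metric on `R`. -/
noncomputable def prefDist (r r' : Pref Ω O) : ℝ :=
  ⨆ f : Act Ω O, |evOf r f - evOf r' f|

/-- Continuity of a real-valued function on `R` with respect to the uniform
metric. -/
def ContOnR (h : Pref Ω O → ℝ) : Prop :=
  ∀ r : Pref Ω O, IsSEU r → ¬ CompletelyIndifferent r →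
    ∀ ε : ℝ, 0 < ε → ∃ δ : ℝ, 0 < δ ∧
      ∀ r' : Pref Ω O, IsSEU r' → ¬ CompletelyIndifferent r' →
        prefDist r r' < δ → |h r' - h r| < ε

/-- Open sets of `R̄`: the whole space `R̄` together with the metrically open
subsets of `R`. -/
def OpenInRbar (S : Set (Pref Ω O)) : Prop :=
  S = {r | IsSEU r} ∨
    ∀ r ∈ S, IsSEU r ∧ ¬ CompletelyIndifferent r ∧
      ∃ ε : ℝ, 0 < ε ∧ ∀ r' : Pref Ω O, IsSEU r' → ¬ CompletelyIndifferent r' →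
        prefDist r r' < ε → r' ∈ S

/-- Restricted monotonicity (on a domain `D` of profiles). -/
def RestrictedMonotonicityOn (D : (I → Pref Ω O) → Prop)
    (Φ : (I → Pref Ω O) → Pref Ω O) : Prop :=
  ∀ (i : I) (p : I → Pref Ω O), D p →
    ∀ πsi πi : Measure Ω,
      RepresentsBelief πsi (Φ (updIndiff p i)) → RepresentsBelief πi (p i) →
      ∀ f g : Act Ω O,
        Φ (updIndiff p i) f g → Φ (updIndiff p i) g f →
        Measure.map f.1 πsi = Measure.map f.1 πi →
        Measure.map g.1 πsi = Measure.map g.1 πi →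
        (p i f g → Φ p f g) ∧ ((p i f g ∧ ¬ p i g f) → (Φ p f g ∧ ¬ Φ p g f))

abbrev RestrictedMonotonicity (Φ : (I → Pref Ω O) → Pref Ω O) : Prop :=
  RestrictedMonotonicityOn IsProfile Φ

/-- Faithfulness (on a domain `D`). -/
def FaithfulOn (D : (I → Pref Ω O) → Prop) (Φ : (I → Pref Ω O) → Pref Ω O) : Prop :=
  ∀ p : I → Pref Ω O, D p → (∀ i, CompletelyIndifferent (p i)) →
    CompletelyIndifferent (Φ p)

abbrev Faithful (Φ : (I → Pref Ω O) → Pref Ω O) : Prop := FaithfulOn IsProfile Φ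

/-- No belief imposition (on a domain `D`). -/
def NoBeliefImpositionOn (D : (I → Pref Ω O) → Prop)
    (Φ : (I → Pref Ω O) → Pref Ω O) : Prop :=
  ∀ (i : I) (p : I → Pref Ω O), D p →
    ¬ CompletelyIndifferent (Φ (updIndiff p i)) →
    ¬ CompletelyIndifferent (Φ p) →
    ¬ CompletelyIndifferent (p i) →
    ∀ πsi π πi : Measure Ω,
      RepresentsBelief πsi (Φ (updIndiff p i)) →
      RepresentsBelief π (Φ p) → RepresentsBelief πi (p i) →
      πsi ≠ πi → π ≠ πi

abbrev NoBeliefImposition (Φ : (I → Pref Ω O) → Pref Ω O) : Prop :=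
  NoBeliefImpositionOn IsProfile Φ

/-- Continuity of an SWF (on a domain `D`), with respect to the topology of
`R̄` and the product topology on profiles. -/
def ContinuousSWFOn (D : (I → Pref Ω O) → Prop)
    (Φ : (I → Pref Ω O) → Pref Ω O) : Prop :=
  ∀ S : Set (Pref Ω O), OpenInRbar S →
    ∀ p : I → Pref Ω O, D p → Φ p ∈ S →
      ∃ T : I → Set (Pref Ω O), (∀ i, OpenInRbar (T i)) ∧ (∀ i, p i ∈ T i) ∧
        ∀ q : I → Pref Ω O, D q → (∀ i, q i ∈ T i) → Φ q ∈ S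

abbrev ContinuousSWF (Φ : (I → Pref Ω O) → Pref Ω O) : Prop :=
  ContinuousSWFOn IsProfile Φ

/-- Anonymity (on a domain `D`). -/
def AnonymousOn (D : (I → Pref Ω O) → Prop)
    (Φ : (I → Pref Ω O) → Pref Ω O) : Prop :=
  ∀ p : I → Pref Ω O, D p → ∀ η : Equiv.Perm I, Φ (fun i => p (η i)) = Φ p

abbrev Anonymous (Φ : (I → Pref Ω O) → Pref Ω O) : Prop := AnonymousOn IsProfile Φ

/-- The regular set of acts `𝒜(ℰ', O')`. -/
def RegularActs (m' : MeasurableSpace Ω) (O' : Set O) : Set (@Act Ω O mΩ mO) :=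
  {f : @Act Ω O mΩ mO | @Measurable Ω O m' mO f.1 ∧ Set.range f.1 ⊆ O'}

/-- `𝒜(ℰ', O')` is co-redundant for `p` (with representing beliefs `πa`). -/
def CoRedundant (m' : MeasurableSpace Ω) (O' : Set O)
    (p : I → @Pref Ω O mΩ mO) (πa : I → @MeasureTheory.Measure Ω mΩ) : Prop :=
  (∀ f : @Act Ω O mΩ mO, ∃ g ∈ @RegularActs Ω O mΩ mO m' O', ∀ i, p i f g ∧ p i g f) ∧
  (∀ i, @NonatomicOn Ω mΩ (πa i) m')

/-- Independence of redundant acts (on a domain `D`). -/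
def IndepRedundantActsOn (D : (I → Pref Ω O) → Prop)
    (Φ : (I → Pref Ω O) → Pref Ω O) : Prop :=
  ∀ (p p' : I → Pref Ω O) (πa πa' : I → Measure Ω),
    D p → D p' →
    (∀ i, RepresentsBelief (πa i) (p i)) →
    (∀ i, RepresentsBelief (πa' i) (p' i)) →
    ∀ (m' : {m : MeasurableSpace Ω // m ≤ mΩ}) (O' : Set O),
      CoRedundant m'.1 O' p πa → CoRedundant m'.1 O' p' πa' →
      (∀ i : I, ∀ f ∈ RegularActs m'.1 O', ∀ g ∈ RegularActs m'.1 O',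
        (p i f g ↔ p' i f g)) →
      ∀ f ∈ RegularActs m'.1 O', ∀ g ∈ RegularActs m'.1 O',
        (Φ p f g ↔ Φ p' f g)

abbrev IndepRedundantActs (Φ : (I → Pref Ω O) → Pref Ω O) : Prop :=
  IndepRedundantActsOn IsProfile Φ

/-- The weighted average of the concerned agents' beliefs with weights `v`. -/
noncomputable def mixBelief [Fintype I] (p : I → Pref Ω O) (πa : I → Measure Ω)
    (v : I → ℝ) : Measure Ω :=
  (ENNReal.ofReal ((∑ i ∈ concerned p, v i)⁻¹)) •
    ∑ i ∈ concerned p, ENNReal.ofReal (v i) • πa i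

/-- The weighted sum of the concerned agents' utility functions with weights
`w`. -/
noncomputable def mixUtil [Fintype I] (p : I → Pref Ω O) (ua : I → O → ℝ)
    (w : I → ℝ) : O → ℝ :=
  fun x => ∑ i ∈ concerned p, w i * ua i x

/-- A common utility profile: every concerned agent's normalized utility
function is equivalent to `u` or to `-u` for a single `u ∈ 𝒰`. -/
def CommonUtilityProfile [Fintype I] (p : I → Pref Ω O) (ua : I → O → ℝ) : Prop :=
  ∃ u : O → ℝ, NormalizedUtility u ∧
    ∀ i ∈ concerned p, UEquiv (ua i) u ∨ UEquiv (ua i) (fun x => - u x)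

end Framework
section Lyapunov
open Filter Topology

variable {Ω : Type*} [mΩ : MeasurableSpace Ω]

/-- Small positive-measure subsets exist for non-atomic finite measures. -/
lemma small_sub_nonatomic (l : Measure Ω) [IsFiniteMeasure l] (hl : NonatomicOn l mΩ)
    (E : Set Ω) (hE : MeasurableSet E) (hpos : 0 < l.real E) (n : ℕ) :
    ∃ F, MeasurableSet F ∧ F ⊆ E ∧ 0 < l.real F ∧ l.real F ≤ l.real E / 2 ^ n := by
  induction n with
  | zero => exact ⟨E, hE, subset_rfl, hpos, by simp⟩
  | succ n ih =>
    obtain ⟨F, hF, hFE, hF0, hFn⟩ := ih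
    have h0 : 0 < l F := by
      rw [Measure.real, ENNReal.toReal_pos_iff] at hF0
      exact hF0.1
    obtain ⟨G, hG, hGF, hG0, hGlt⟩ := hl F hF h0
    have hG0' : 0 < l.real G := ENNReal.toReal_pos hG0.ne' (measure_ne_top _ _)
    have hGlt' : l.real G < l.real F :=
      (ENNReal.toReal_lt_toReal (measure_ne_top _ _) (measure_ne_top _ _)).2 hGlt
    have hd : l.real (F \ G) = l.real F - l.real G := measureReal_sdiff hGF hG
    have e : l.real E / 2 ^ (n + 1) = l.real E / 2 ^ n / 2 := by
      rw [pow_succ]; field_simp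
    rcases le_total (l.real G) (l.real F / 2) with h | h
    · exact ⟨G, hG, hGF.trans hFE, hG0', by rw [e]; linarith⟩
    · refine ⟨F \ G, hF.diff hG, Set.sdiff_subset.trans hFE, ?_, ?_⟩
      · rw [hd]; linarith
      · rw [hd, e]; linarith

lemma tendsto_real_iUnion (l : Measure Ω) [IsFiniteMeasure l] {s : ℕ → Set Ω}
    (hs : Monotone s) :
    Tendsto (fun n => l.real (s n)) atTop (𝓝 (l.real (⋃ n, s n))) :=
  (ENNReal.tendsto_toReal (measure_ne_top _ _)).comp (tendsto_measure_iUnion_atTop hs)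

/-- Sierpinski's theorem. -/
lemma sierpinski (l : Measure Ω) [IsFiniteMeasure l] (hl : NonatomicOn l mΩ)
    (E : Set Ω) (hE : MeasurableSet E) (c : ℝ) (hc0 : 0 ≤ c) (hcE : c ≤ l.real E) :
    ∃ F, MeasurableSet F ∧ F ⊆ E ∧ l.real F = c := by
  let P : Set Ω → Prop := fun F => MeasurableSet F ∧ F ⊆ E ∧ l.real F ≤ c
  have step : ∀ F : {F // P F}, ∃ F' : {F // P F}, F.1 ⊆ F'.1 ∧
      ∀ H, P H → F.1 ⊆ H → l.real H - l.real F.1 ≤ 2 * (l.real F'.1 - l.real F.1) := by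
    intro F
    let T : Set ℝ := {r | ∃ H, P H ∧ F.1 ⊆ H ∧ l.real H = r}
    have hTb : BddAbove T := ⟨c, by rintro r ⟨H, hH, _, rfl⟩; exact hH.2.2⟩
    have hTn : T.Nonempty := ⟨_, F.1, F.2, subset_rfl, rfl⟩
    have hle : ∀ H, P H → F.1 ⊆ H → l.real H ≤ sSup T := fun H hH hFH =>
      le_csSup hTb ⟨H, hH, hFH, rfl⟩
    rcases (hle F.1 F.2 subset_rfl).eq_or_lt with h | h
    · refine ⟨F, subset_rfl, fun H hH hFH => ?_⟩
      have := hle H hH hFH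
      linarith
    · obtain ⟨r, ⟨H, hH, hFH, rfl⟩, hr⟩ := exists_lt_of_lt_csSup hTn
        (show (l.real F.1 + sSup T) / 2 < sSup T by linarith)
      refine ⟨⟨H, hH⟩, hFH, fun H' hH' hFH' => ?_⟩
      have := hle H' hH' hFH'
      simp only
      linarith
  choose nxt hnxt1 hnxt2 using step
  let S : ℕ → {F // P F} := fun n =>
    Nat.rec ⟨∅, MeasurableSet.empty, Set.empty_subset _, by simpa using hc0⟩ (fun _ F => nxt F) n
  have hS : ∀ n, S (n + 1) = nxt (S n) := fun n => rfl
  have hmono : Monotone (fun n => (S n).1) := monotone_nat_of_le_succ fun n => by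
    rw [hS]; exact hnxt1 _
  have hlim := tendsto_real_iUnion l hmono
  set F := ⋃ n, (S n).1 with hF
  have hPF : P F := ⟨MeasurableSet.iUnion fun n => (S n).2.1, Set.iUnion_subset fun n => (S n).2.2.1,
    le_of_tendsto' hlim fun n => (S n).2.2.2⟩
  have hmax : ∀ H, P H → F ⊆ H → l.real H ≤ l.real F := by
    intro H hH hFH
    have h1 : Tendsto (fun n => 2 * (l.real (S (n+1)).1 - l.real (S n).1)) atTop (𝓝 0) := by
      have := ((hlim.comp (tendsto_add_atTop_nat 1)).sub hlim).const_mul 2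
      simpa using this
    have h2 : Tendsto (fun n => l.real H - l.real (S n).1) atTop (𝓝 (l.real H - l.real F)) :=
      hlim.const_sub _
    have := le_of_tendsto_of_tendsto' h2 h1 fun n => by
      rw [hS]; exact hnxt2 _ H hH ((Set.subset_iUnion _ n).trans hFH)
    linarith
  refine ⟨F, hPF.1, hPF.2.1, le_antisymm hPF.2.2 ?_⟩
  by_contra! hlt
  have hd : l.real (E \ F) = l.real E - l.real F := measureReal_sdiff hPF.2.1 hPF.1
  have hdpos : 0 < l.real (E \ F) := by rw [hd]; linarith
  obtain ⟨n, hn⟩ := exists_pow_lt_of_lt_one (show 0 < (c - l.real F) / l.real (E \ F) from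
    div_pos (by linarith) hdpos) (show (1/2 : ℝ) < 1 by norm_num)
  obtain ⟨G, hG, hGE, hG0, hGn⟩ := small_sub_nonatomic l hl (E \ F) (hE.diff hPF.1) hdpos n
  have hG' : l.real G ≤ c - l.real F := by
    rw [lt_div_iff₀ hdpos] at hn
    have : l.real (E \ F) / 2 ^ n = (1/2) ^ n * l.real (E \ F) := by
      rw [div_pow]; field_simp; simp
    linarith
  have hdisj : Disjoint F G := Set.disjoint_left.2 fun x hx hxG => (hGE hxG).2 hx
  have hu : l.real (F ∪ G) = l.real F + l.real G := measureReal_union hdisj hG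
  have := hmax (F ∪ G) ⟨hPF.1.union hG, Set.union_subset hPF.2.1 (hGE.trans Set.sdiff_subset),
    by rw [hu]; linarith⟩ Set.subset_union_left
  linarith

/-- Every event can be halved simultaneously for all measures in `M`. -/
def Halves (M : Set (Measure Ω)) : Prop :=
  ∀ E, MeasurableSet E → ∃ F, MeasurableSet F ∧ F ⊆ E ∧ ∀ μ ∈ M, μ.real F = μ.real E / 2

lemma Halves.chain {M : Set (Measure Ω)} (hM : Halves M) (hfin : ∀ μ ∈ M, IsFiniteMeasure μ)
    (E : Set Ω) (hE : MeasurableSet E) :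
    ∃ A : ℝ → Set Ω, (∀ t, MeasurableSet (A t)) ∧ Monotone A ∧ (∀ t, t ≤ 1 → A t ⊆ E) ∧
      ∀ μ ∈ M, ∀ t, 0 ≤ t → t ≤ 1 → μ.real (A t) = t * μ.real E := by
  choose! half hh1 hh2 hh3 using hM
  let D : ℕ → ℕ → Set Ω := fun n => Nat.rec (fun m => if m = 0 then ∅ else E)
    (fun _ d m => if m % 2 = 0 then d (m / 2)
      else d (m / 2) ∪ half (d (m / 2 + 1) \ d (m / 2))) n
  have D0 : ∀ m, D 0 m = if m = 0 then ∅ else E := fun m => rfl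
  have DS : ∀ n m, D (n+1) m = if m % 2 = 0 then D n (m / 2)
      else D n (m / 2) ∪ half (D n (m / 2 + 1) \ D n (m / 2)) := fun n m => rfl
  have Dev : ∀ n m, D (n+1) (2 * m) = D n m := fun n m => by simp [DS]
  have Dod : ∀ n m, D (n+1) (2 * m + 1) = D n m ∪ half (D n (m + 1) \ D n m) := fun n m => by
    have : (2 * m + 1) / 2 = m := by omega
    simp [DS, this, Nat.add_mod]
  have Dmeas : ∀ n m, MeasurableSet (D n m) := by
    intro n
    induction n with
    | zero => intro m; rw [D0]; split_ifs; exacts [MeasurableSet.empty, hE]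
    | succ n ih =>
      intro m; rw [DS]; split_ifs
      · exact ih _
      · exact (ih _).union (hh1 _ ((ih _).diff (ih _)))
  have Dmono : ∀ n, Monotone (D n) := by
    intro n
    induction n with
    | zero =>
      apply monotone_nat_of_le_succ; intro m; rw [D0, D0]
      split_ifs <;> simp_all
    | succ n ih =>
      apply monotone_nat_of_le_succ; intro m
      obtain ⟨k, rfl | rfl⟩ := Nat.even_or_odd' m
      · rw [Dev, Dod]; exact Set.subset_union_left
      · rw [show 2 * k + 1 + 1 = 2 * (k + 1) by ring, Dev, Dod]
        exact Set.union_subset (ih (Nat.le_succ k))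
          ((hh2 _ ((Dmeas _ _).diff (Dmeas _ _))).trans Set.sdiff_subset)
  have Dsub : ∀ n m, D n m ⊆ E := by
    intro n
    induction n with
    | zero => intro m; rw [D0]; split_ifs <;> simp
    | succ n ih =>
      intro m; rw [DS]; split_ifs
      · exact ih _
      · exact Set.union_subset (ih _)
          (((hh2 _ ((Dmeas _ _).diff (Dmeas _ _))).trans Set.sdiff_subset).trans (ih _))
  have Dval : ∀ μ ∈ M, ∀ n m, m ≤ 2 ^ n → μ.real (D n m) = (m / 2 ^ n : ℝ) * μ.real E := by
    intro μ hμ n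
    have := hfin μ hμ
    induction n with
    | zero =>
      intro m hm
      have : m = 0 ∨ m = 1 := by simp at hm; omega
      rcases this with rfl | rfl <;> simp [D0]
    | succ n ih =>
      intro m hm
      obtain ⟨k, rfl | rfl⟩ := Nat.even_or_odd' m
      · rw [Dev, ih k (by rw [pow_succ] at hm; omega)]
        push_cast; rw [pow_succ]; field_simp
      · have hk : k + 1 ≤ 2 ^ n := by rw [pow_succ] at hm; omega
        have hsub := hh2 _ ((Dmeas n (k+1)).diff (Dmeas n k))
        rw [Dod, measureReal_union (Set.disjoint_left.2 fun x hx hx' => (hsub hx').2 hx)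
          (hh1 _ ((Dmeas _ _).diff (Dmeas _ _))), hh3 _ ((Dmeas _ _).diff (Dmeas _ _)) μ hμ,
          measureReal_sdiff (Dmono n (Nat.le_succ k)) (Dmeas _ _), ih _ hk, ih k (by omega)]
        push_cast; rw [pow_succ]; field_simp; ring
  refine ⟨fun t => ⋃ n, D n ⌊t * 2 ^ n⌋₊, fun t => MeasurableSet.iUnion fun n => Dmeas _ _,
    fun s t hst => Set.iUnion_mono fun n => Dmono n (Nat.floor_mono (by gcongr)),
    fun t _ => Set.iUnion_subset fun n => Dsub _ _, ?_⟩
  intro μ hμ t ht0 ht1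
  have := hfin μ hμ
  have hmono : Monotone fun n => D n ⌊t * 2 ^ n⌋₊ := by
    apply monotone_nat_of_le_succ
    intro n
    rw [← Dev]
    refine Dmono (n + 1) ?_
    apply Nat.le_floor
    push_cast
    have := Nat.floor_le (show 0 ≤ t * 2 ^ n by positivity)
    rw [pow_succ]; linarith
  refine tendsto_nhds_unique (tendsto_real_iUnion μ hmono) ?_
  have hval : ∀ n, μ.real (D n ⌊t * 2 ^ n⌋₊) = (⌊t * 2 ^ n⌋₊ / 2 ^ n : ℝ) * μ.real E := by
    intro n
    apply Dval μ hμ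
    apply Nat.floor_le_of_le
    push_cast
    have : (0:ℝ) < 2 ^ n := by positivity
    nlinarith
  simp_rw [hval]
  apply Tendsto.mul_const
  exact (tendsto_nat_floor_mul_div_atTop ht0).comp
    (tendsto_pow_atTop_atTop_of_one_lt (by norm_num : (1:ℝ) < 2))

lemma Halves.insert {M : Set (Measure Ω)} (hM : Halves M) (hfin : ∀ μ ∈ M, IsFiniteMeasure μ)
    (l : Measure Ω) (hl : l ∈ M) (ν : Measure Ω) (hν : ν ≤ l) : Halves (insert ν M) := by
  intro E hE
  obtain ⟨A, hAm, hAmono, hAE, hA⟩ := hM.chain hfin E hE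
  have := hfin l hl
  have hνfin : IsFiniteMeasure ν := isFiniteMeasure_of_le l hν
  have hle : ∀ S, ν.real S ≤ l.real S := fun S =>
    ENNReal.toReal_mono (measure_ne_top _ _) (hν S)
  have hlip : ∀ s ∈ Set.Icc (0:ℝ) 1, ∀ t ∈ Set.Icc (0:ℝ) 1, s ≤ t →
      |ν.real (A t) - ν.real (A s)| ≤ l.real E * |t - s| := by
    intro s hs t ht hst
    have h1 : ν.real (A t \ A s) = ν.real (A t) - ν.real (A s) :=
      measureReal_sdiff (hAmono hst) (hAm _)
    have h2 : l.real (A t \ A s) = l.real (A t) - l.real (A s) :=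
      measureReal_sdiff (hAmono hst) (hAm _)
    rw [← h1, abs_of_nonneg measureReal_nonneg, abs_of_nonneg (by linarith)]
    refine (hle _).trans ?_
    rw [h2, hA l hl t ht.1 ht.2, hA l hl s hs.1 hs.2]
    apply le_of_eq; ring
  have hcont : ContinuousOn (fun t => ν.real (A t)) (Set.Icc 0 1) := by
    apply LipschitzOnWith.continuousOn (K := (l.real E).toNNReal)
    apply LipschitzOnWith.of_dist_le_mul
    intro s hs t ht
    rw [Real.coe_toNNReal _ measureReal_nonneg, Real.dist_eq, Real.dist_eq]
    rcases le_total s t with h | h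
    · rw [abs_sub_comm, abs_sub_comm s]; exact hlip s hs t ht h
    · exact hlip t ht s hs h
  let φ : ℝ → ℝ := fun t => ν.real (A (t + 1/2)) - ν.real (A t)
  have hφ : ContinuousOn φ (Set.Icc 0 (1/2)) := by
    apply ContinuousOn.sub
    · apply hcont.comp (by fun_prop)
      intro t ht; constructor <;> linarith [ht.1, ht.2]
    · apply hcont.mono
      intro t ht; constructor <;> linarith [ht.1, ht.2]
  have hν0 : ν.real (A 0) = 0 := by
    have h1 := hle (A 0)
    rw [hA l hl 0 le_rfl zero_le_one, zero_mul] at h1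
    exact le_antisymm h1 measureReal_nonneg
  have hν1 : ν.real (A 1) = ν.real E := by
    have h2 : l.real (E \ A 1) = l.real E - l.real (A 1) := measureReal_sdiff (hAE 1 le_rfl) (hAm _)
    have h3 : ν.real (E \ A 1) = ν.real E - ν.real (A 1) := measureReal_sdiff (hAE 1 le_rfl) (hAm _)
    have h1 := hle (E \ A 1)
    rw [h2, hA l hl 1 zero_le_one le_rfl] at h1
    have : 0 ≤ ν.real (E \ A 1) := measureReal_nonneg
    linarith
  have hsum : φ 0 + φ (1/2) = ν.real E := by
    simp only [φ]
    rw [show (1/2 + 1/2 : ℝ) = 1 by norm_num, hν0, hν1]; ring_nf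
  have hmem : ν.real E / 2 ∈ Set.uIcc (φ 0) (φ (1/2)) := by
    rw [Set.mem_uIcc]
    rcases le_total (φ 0) (φ (1/2)) with h | h
    · left; constructor <;> linarith
    · right; constructor <;> linarith
  obtain ⟨t, ht, hφt⟩ := intermediate_value_uIcc (by rwa [Set.uIcc_of_le (by norm_num)]) hmem
  rw [Set.uIcc_of_le (by norm_num)] at ht
  refine ⟨A (t + 1/2) \ A t, (hAm _).diff (hAm _),
    Set.sdiff_subset.trans (hAE _ (by linarith [ht.2])), ?_⟩
  intro μ hμ
  rcases hμ with rfl | hμ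
  · rw [measureReal_sdiff (hAmono (by linarith)) (hAm _)]; exact hφt
  · have := hfin μ hμ
    rw [measureReal_sdiff (hAmono (by linarith)) (hAm _),
      hA μ hμ _ (by linarith [ht.1]) (by linarith [ht.2]), hA μ hμ t ht.1 (by linarith [ht.2])]
    ring

/-- Lyapunov for three beliefs: any fraction of an event. -/
lemma lyapunov3 (μ : Fin 3 → Measure Ω) (hμ : ∀ j, IsBelief (μ j)) (E : Set Ω)
    (hE : MeasurableSet E) (t : ℝ) (ht0 : 0 ≤ t) (ht1 : t ≤ 1) :
    ∃ F, MeasurableSet F ∧ F ⊆ E ∧ ∀ j, (μ j).real F = t * (μ j).real E := by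
  have := fun j => (hμ j).1
  let l : Measure Ω := μ 0 + μ 1 + μ 2
  have hle : ∀ j, μ j ≤ l := by
    intro j S
    simp only [l, Measure.add_apply]
    fin_cases j
    · simp only [Fin.zero_eta]; rw [add_assoc]; exact le_self_add
    · simp only [Fin.mk_one]; rw [add_comm (μ 0 S), add_assoc]; exact le_self_add
    · exact le_add_self
  have hna : NonatomicOn l mΩ := by
    intro S hS hpos
    have : ∃ j, 0 < μ j S := by
      by_contra! h
      simp only [l, Measure.add_apply] at hpos
      simp [nonpos_iff_eq_zero.1 (h _)] at hpos
    obtain ⟨j, hj⟩ := this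
    obtain ⟨F, hF, hFS, hF0, hFlt⟩ := (hμ j).2 S hS hj
    refine ⟨F, hF, hFS, hF0.trans_le (hle j F), ?_⟩
    have h1 : 0 < μ j (S \ F) := by
      rw [measure_sdiff hFS hF.nullMeasurableSet (measure_ne_top _ _)]
      exact tsub_pos_of_lt hFlt
    have h2 : 0 < l (S \ F) := h1.trans_le (hle j _)
    have h3 := measure_sdiff hFS hF.nullMeasurableSet (measure_ne_top l F)
    rw [h3] at h2
    exact tsub_pos_iff_lt.1 h2
  have H0 : Halves {l} := by
    intro S hS
    obtain ⟨F, hF, hFS, h⟩ := sierpinski l hna S hS (l.real S / 2)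
      (by have : 0 ≤ l.real S := measureReal_nonneg
          linarith) (by have : 0 ≤ l.real S := measureReal_nonneg
                        linarith)
    exact ⟨F, hF, hFS, by simpa using h⟩
  have hfl : IsFiniteMeasure l := by infer_instance
  have H1 := H0.insert (by simpa using hfl) l (by simp) (μ 0) (hle 0)
  have H2 := H1.insert (by rintro _ (rfl | rfl) <;> infer_instance) l (by simp) (μ 1) (hle 1)
  have H3 := H2.insert (by rintro _ (rfl | rfl | rfl) <;> infer_instance) l (by simp) (μ 2) (hle 2)
  obtain ⟨A, hA1, _, hA2, hA3⟩ := H3.chain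
    (by rintro _ (rfl | rfl | rfl | rfl) <;> infer_instance) E hE
  refine ⟨A t, hA1 t, hA2 t ht1, fun j => hA3 _ ?_ t ht0 ht1⟩
  fin_cases j <;> simp

end Lyapunov

section Lotteries

variable {Ω O I : Type*} [mΩ : MeasurableSpace Ω] [mO : MeasurableSpace O]

/-- Set functions that arise as conditional laws of acts, simultaneously under all measures. -/
def SimLaws (μ : Fin 3 → Measure Ω) : Set (Set O → ℝ) :=
  {ν | ∀ E, MeasurableSet E → ∃ f : Act Ω O, ∀ j, ∀ S, MeasurableSet S →
    (μ j).real (E ∩ f.1 ⁻¹' S) = (μ j).real E * ν S}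

lemma simLaws_convex (μ : Fin 3 → Measure Ω) (hμ : ∀ j, IsBelief (μ j)) :
    Convex ℝ (SimLaws (O := O) μ) := by
  have := fun j => (hμ j).1
  intro ν₁ h₁ ν₂ h₂ a b ha hb hab E hE
  obtain ⟨F, hF, hFE, hFv⟩ := lyapunov3 μ hμ E hE a ha (by linarith)
  obtain ⟨f, hf⟩ := h₁ F hF
  obtain ⟨g, hg⟩ := h₂ (E \ F) (hE.diff hF)
  classical
  refine ⟨⟨F.piecewise f.1 g.1, Measurable.piecewise hF f.2 g.2⟩, fun j S hS => ?_⟩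
  have hset : E ∩ (F.piecewise f.1 g.1) ⁻¹' S = (F ∩ f.1 ⁻¹' S) ∪ ((E \ F) ∩ g.1 ⁻¹' S) := by
    ext x
    by_cases hx : x ∈ F
    · have := hFE hx
      simp [hx, this]
    · simp [hx]
  simp only
  rw [hset, measureReal_union (Set.disjoint_left.2 fun x hx hx' => hx'.1.2 hx.1)
    ((hE.diff hF).inter (g.2 hS)), hf j S hS, hg j S hS, measureReal_sdiff hFE hF, hFv]
  simp only [Pi.add_apply, Pi.smul_apply, smul_eq_mul]
  have hb' : b = 1 - a := by linarith
  subst hb'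
  ring

lemma exists_act (μ : Fin 3 → Measure Ω) (hμ : ∀ j, IsBelief (μ j)) (s : Finset O) (q : O → ℝ)
    (hq : ∀ x ∈ s, 0 ≤ q x) (hq1 : ∑ x ∈ s, q x = 1) :
    ∃ f : Act Ω O, (∀ j, Measure.map f.1 (μ j) = ∑ x ∈ s, ENNReal.ofReal (q x) • Measure.dirac x) ∧
      ∀ j, ∀ u : O → ℝ, IsUtility u → ev (μ j) u f = ∑ x ∈ s, q x * u x := by
  have := fun j => (hμ j).1
  have hmem : ∑ x ∈ s, q x • (fun S : Set O => S.indicator (fun _ => (1:ℝ)) x) ∈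
      SimLaws (O := O) μ := by
    apply (simLaws_convex μ hμ).sum_mem hq hq1
    intro x _ E hE
    refine ⟨⟨fun _ => x, measurable_const⟩, fun j S hS => ?_⟩
    by_cases hx : x ∈ S <;> simp [hx]
  obtain ⟨f, hf⟩ := hmem Set.univ MeasurableSet.univ
  have hmap : ∀ j, Measure.map f.1 (μ j) =
      ∑ x ∈ s, ENNReal.ofReal (q x) • Measure.dirac x := by
    intro j
    ext S hS
    rw [Measure.map_apply f.2 hS]
    have h := hf j S hS
    rw [Set.univ_inter, probReal_univ, one_mul, Finset.sum_apply] at h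
    rw [← ofReal_measureReal, h, ENNReal.ofReal_sum_of_nonneg]
    · simp only [Measure.coe_finsetSum, Finset.sum_apply, Measure.smul_apply,
        Measure.dirac_apply' _ hS]
      refine Finset.sum_congr rfl fun x hx => ?_
      by_cases hxS : x ∈ S <;> simp [hxS]
    · intro x hx
      by_cases hxS : x ∈ S <;> simp [hxS, hq x hx]
  refine ⟨f, hmap, fun j u hu => ?_⟩
  have hintegr : ∀ (ν : Measure O) [IsFiniteMeasure ν], Integrable u ν := by
    intro ν _
    obtain ⟨M, hM⟩ := hu.2
    exact Integrable.of_bound hu.1.aestronglyMeasurable M (Filter.Eventually.of_forall hM)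
  unfold ev
  rw [← integral_map (f := u) f.2.aemeasurable hu.1.aestronglyMeasurable, hmap j,
    integral_finsetSum_measure]
  · refine Finset.sum_congr rfl fun x hx => ?_
    rw [integral_smul_measure, integral_dirac' _ _ hu.1.stronglyMeasurable,
      ENNReal.toReal_ofReal (hq x hx), smul_eq_mul]
  · intro x hx
    exact (hintegr _).smul_measure ENNReal.ofReal_ne_top

/-- The evaluation functional of a function on finitely supported signed lotteries. -/
noncomputable def Lf (v : O → ℝ) : (O →₀ ℝ) →ₗ[ℝ] ℝ := Finsupp.linearCombination ℝ v

lemma Lf_apply (v : O → ℝ) (c : O →₀ ℝ) : Lf v c = ∑ x ∈ c.support, c x * v x := by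
  simp [Lf, Finsupp.linearCombination_apply, Finsupp.sum]

lemma Lf_single (v : O → ℝ) (x : O) : Lf v (Finsupp.single x 1) = v x := by
  simp [Lf]

lemma key_mono (Φ : (I → Pref Ω O) → Pref Ω O) (hmono : RestrictedMonotonicity Φ)
    (p : I → Pref Ω O) (hp : IsProfile p) (i : I)
    (π' πi π : Measure Ω) (u' ui u : O → ℝ)
    (h' : IsBelief π') (hi : IsBelief πi) (h : IsBelief π)
    (hu' : IsUtility u') (hui : IsUtility ui) (hu : IsUtility u)
    (r' : Represents π' u' (Φ (updIndiff p i))) (ri : Represents πi ui (p i))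
    (r : Represents π u (Φ p)) (c : O →₀ ℝ) (hc1 : Lf (fun _ => 1) c = 0) (hc' : Lf u' c = 0) :
    (0 ≤ Lf ui c → 0 ≤ Lf u c) ∧ (0 < Lf ui c → 0 < Lf u c) := by
  set s := c.support with hs
  set m := ∑ x ∈ s, (c x)⁺ with hm
  have hm' : m = ∑ x ∈ s, (c x)⁻ := by
    rw [Lf_apply] at hc1
    simp only [mul_one] at hc1
    have : m - ∑ x ∈ s, (c x)⁻ = 0 := by
      rw [hm, ← Finset.sum_sub_distrib, ← hc1]
      exact Finset.sum_congr rfl fun x _ => posPart_sub_negPart (c x)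
    linarith
  have hm0 : 0 ≤ m := Finset.sum_nonneg fun x _ => posPart_nonneg _
  rcases hm0.eq_or_lt with h0 | hpos
  · have hz : ∀ v : O → ℝ, Lf v c = 0 := by
      intro v
      rw [Lf_apply]
      refine Finset.sum_eq_zero fun x hx => ?_
      have e1 := (Finset.sum_eq_zero_iff_of_nonneg fun x _ => posPart_nonneg (c x)).1
        (hm.symm.trans h0.symm) x hx
      have e2 := (Finset.sum_eq_zero_iff_of_nonneg fun x _ => negPart_nonneg (c x)).1
        (hm'.symm.trans h0.symm) x hx
      rw [← posPart_sub_negPart (c x), e1, e2]; simp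
    simp [hz]
  · let μ : Fin 3 → Measure Ω := ![π', πi, π]
    have hμ : ∀ j, IsBelief (μ j) := by
      intro j; fin_cases j
      exacts [h', hi, h]
    obtain ⟨f, hf1, hf2⟩ := exists_act (O := O) μ hμ s (fun x => (c x)⁺ / m)
      (fun x _ => div_nonneg (posPart_nonneg _) hm0)
      (by rw [← Finset.sum_div, ← hm, div_self hpos.ne'])
    obtain ⟨g, hg1, hg2⟩ := exists_act (O := O) μ hμ s (fun x => (c x)⁻ / m)
      (fun x _ => div_nonneg (negPart_nonneg _) hm0)
      (by rw [← Finset.sum_div, ← hm', div_self hpos.ne'])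
    have hdiff : ∀ j, ∀ v : O → ℝ, IsUtility v → ev (μ j) v f - ev (μ j) v g = Lf v c / m := by
      intro j v hv
      rw [hf2 j v hv, hg2 j v hv, ← Finset.sum_sub_distrib, Lf_apply, Finset.sum_div]
      refine Finset.sum_congr rfl fun x _ => ?_
      nth_rewrite 3 [← posPart_sub_negPart (c x)]
      ring
    have d' : ev π' u' f - ev π' u' g = Lf u' c / m := hdiff 0 u' hu'
    have di : ev πi ui f - ev πi ui g = Lf ui c / m := hdiff 1 ui hui
    have d : ev π u f - ev π u g = Lf u c / m := hdiff 2 u hu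
    rw [hc', zero_div] at d'
    have key := hmono i p hp π' πi ⟨h', u', hu', r'⟩ ⟨hi, ui, hui, ri⟩ f g
      ((r' f g).2 (by linarith)) ((r' g f).2 (by linarith))
      ((hf1 0).trans (hf1 1).symm) ((hg1 0).trans (hg1 1).symm)
    rw [ri f g, ri g f, r f g, r g f] at key
    constructor
    · intro hge
      have : 0 ≤ Lf ui c / m := div_nonneg hge hm0
      have h3 := key.1 (by linarith)
      have h4 : 0 ≤ Lf u c / m := by linarith
      have := mul_nonneg h4 hm0
      rwa [div_mul_cancel₀ _ hpos.ne'] at this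
    · intro hgt
      have : 0 < Lf ui c / m := div_pos hgt hpos
      have h3 := key.2 ⟨by linarith, by linarith⟩
      have h4 : 0 < Lf u c / m := by
        have := lt_of_not_ge h3.2
        linarith
      have := mul_pos h4 hpos
      rwa [div_mul_cancel₀ _ hpos.ne'] at this

lemma span3 (u v w : O → ℝ) (h : ∀ c, Lf (fun _ => 1) c = 0 → Lf v c = 0 → Lf w c = 0 →
    Lf u c = 0) : ∃ a b d : ℝ, ∀ x, u x = a + b * v x + d * w x := by
  have := mem_span_of_iInf_ker_le_ker (L := ![Lf (fun _ : O => (1:ℝ)), Lf v, Lf w]) (K := Lf u) (by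
    intro c hc
    simp only [Submodule.mem_iInf, LinearMap.mem_ker] at hc
    exact h c (hc 0) (hc 1) (hc 2))
  obtain ⟨k, hk⟩ := (Submodule.mem_span_range_iff_exists_fun ℝ).1 this
  refine ⟨k 0, k 1, k 2, fun x => ?_⟩
  have := LinearMap.congr_fun hk (Finsupp.single x 1)
  simp [Fin.sum_univ_three, Lf_single] at this
  linarith

/-- One-step decomposition. -/
lemma one_step (Φ : (I → Pref Ω O) → Pref Ω O) (hmono : RestrictedMonotonicity Φ)
    (p : I → Pref Ω O) (hp : IsProfile p) (i : I)
    (π' πi π : Measure Ω) (u' ui u : O → ℝ)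
    (h' : IsBelief π') (hi : IsBelief πi) (h : IsBelief π)
    (hu' : IsUtility u') (hui : IsUtility ui) (hu : IsUtility u)
    (r' : Represents π' u' (Φ (updIndiff p i))) (ri : Represents πi ui (p i))
    (r : Represents π u (Φ p)) :
    ∃ a b d : ℝ, (∀ x, u x = a + b * u' x + d * ui x) ∧
      ((¬ ∃ a' b' : ℝ, ∀ x, ui x = a' + b' * u' x) → 0 < d) := by
  have K := key_mono Φ hmono p hp i π' πi π u' ui u h' hi h hu' hui hu r' ri r
  obtain ⟨a, b, d, habd⟩ := span3 u u' ui (by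
    intro c h1 h2 h3
    have k1 := (K c h1 h2).1 h3.ge
    have k2 := (K (-c) (by simp [h1]) (by simp [h2])).1 (by simp [h3])
    rw [map_neg] at k2
    linarith)
  refine ⟨a, b, d, habd, fun hnot => ?_⟩
  have hex : ∃ c, Lf (fun _ => 1) c = 0 ∧ Lf u' c = 0 ∧ Lf ui c ≠ 0 := by
    by_contra! hcon
    obtain ⟨a', b', d', hx⟩ := span3 ui u' u' (fun c h1 h2 _ => hcon c h1 h2)
    exact hnot ⟨a', b' + d', fun x => by rw [hx]; ring⟩
  have hex2 : ∃ c, Lf (fun _ => 1) c = 0 ∧ Lf u' c = 0 ∧ 0 < Lf ui c := by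
    obtain ⟨c, h1, h2, h3⟩ := hex
    rcases h3.lt_or_gt with h | h
    · exact ⟨-c, by simp [h1], by simp [h2], by rw [map_neg]; linarith⟩
    · exact ⟨c, h1, h2, h⟩
  obtain ⟨c, h1, h2, h3⟩ := hex2
  have h4 := (K c h1 h2).2 h3
  have h5 : Lf u c = a * Lf (fun _ => 1) c + b * Lf u' c + d * Lf ui c := by
    simp only [Lf_apply, Finset.mul_sum, ← Finset.sum_add_distrib]
    refine Finset.sum_congr rfl fun x _ => ?_
    rw [habd]; ring
  rw [h5, h1, h2, mul_zero, mul_zero, zero_add, zero_add] at h4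
  exact pos_of_mul_pos_left h4 h3.le

lemma mem_concerned [Fintype I] (p : I → Pref Ω O) (i : I) :
    i ∈ concerned p ↔ ¬ CompletelyIndifferent (p i) := by
  simp [concerned]

lemma concerned_upd [Fintype I] [DecidableEq I] (p : I → Pref Ω O) (i : I) :
    concerned (updIndiff p i) = (concerned p).erase i := by
  ext j
  rw [Finset.mem_erase, mem_concerned, mem_concerned]
  by_cases hj : j = i
  · subst hj; simp [updIndiff, CompletelyIndifferent, indiffRel]
  · simp [updIndiff, hj]

lemma isProfile_upd (p : I → Pref Ω O) (hp : IsProfile p) (i : I) : IsProfile (updIndiff p i) := by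
  intro j
  by_cases hj : j = i
  · obtain ⟨π, _, hπ, _⟩ := hp i
    refine ⟨π, fun _ => 0, hπ, ⟨measurable_const, 0, by simp⟩, ?_⟩
    intro f g
    simp [updIndiff, hj, indiffRel, ev]
  · simpa [updIndiff, hj] using hp j

lemma in_span [Fintype I] (Φ : (I → Pref Ω O) → Pref Ω O)
    (hSWF : ∀ p : I → Pref Ω O, IsProfile p → IsSEU (Φ p))
    (hmono : RestrictedMonotonicity Φ) (hfaith : Faithful Φ)
    (πa : I → Measure Ω) (ua : I → O → ℝ) (n : ℕ) :
    ∀ (p : I → Pref Ω O), IsProfile p → (concerned p).card = n →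
    (∀ i ∈ concerned p, IsBelief (πa i) ∧ IsUtility (ua i) ∧ Represents (πa i) (ua i) (p i)) →
    ∀ (π : Measure Ω) (u : O → ℝ), IsBelief π → IsUtility u → Represents π u (Φ p) →
    ∃ (w : I → ℝ) (e : ℝ), ∀ x, u x = (∑ i ∈ concerned p, w i * ua i x) + e := by
  classical
  induction n with
  | zero =>
    intro p hp hcard _ π u hπ hu hr
    have hemp := Finset.card_eq_zero.1 hcard
    have hCI := hfaith p hp (fun i => by
      by_contra hi
      have := (mem_concerned p i).2 hi
      simp [hemp] at this)
    have := hπ.1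
    have hle : ∀ x y, u x ≤ u y := by
      intro x y
      have := (hr ⟨fun _ => y, measurable_const⟩ ⟨fun _ => x, measurable_const⟩).1 (hCI _ _)
      simpa [ev] using this
    by_cases hne : Nonempty O
    · obtain ⟨x0⟩ := hne
      exact ⟨0, u x0, fun x => by simpa using le_antisymm (hle _ _) (hle _ _)⟩
    · exact ⟨0, 0, fun x => (hne ⟨x⟩).elim⟩
  | succ n ih =>
    intro p hp hcard hrep π u hπ hu hr
    obtain ⟨i, hi⟩ := Finset.card_pos.1 (by omega : 0 < (concerned p).card)
    have hp' := isProfile_upd p hp i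
    obtain ⟨π', u', h', hu', r'⟩ := hSWF _ hp'
    have hc := concerned_upd p i
    obtain ⟨v, e, hv⟩ := ih (updIndiff p i) hp' (by
      rw [hc, Finset.card_erase_of_mem hi, hcard]; rfl) (by
      intro j hj
      rw [hc, Finset.mem_erase] at hj
      have := hrep j hj.2
      simpa [updIndiff, hj.1] using this) π' u' h' hu' r'
    obtain ⟨hbi, hui, ri⟩ := hrep i hi
    obtain ⟨a, b, d, habd, _⟩ := one_step Φ hmono p hp i π' (πa i) π u' (ua i) u h' hbi hπ
      hu' hui hu r' ri hr
    refine ⟨fun j => if j = i then d else b * v j, a + b * e, fun x => ?_⟩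
    rw [habd, hv, hc, ← Finset.add_sum_erase _ _ hi]
    have : ∑ j ∈ (concerned p).erase i, (if j = i then d else b * v j) * ua j x =
        b * ∑ j ∈ (concerned p).erase i, v j * ua j x := by
      rw [Finset.mul_sum]
      refine Finset.sum_congr rfl fun j hj => ?_
      rw [if_neg (Finset.mem_erase.1 hj).1]; ring
    rw [this]; simp only [if_true]; ring

lemma utility_of_bar (u : O → ℝ) (h : NormalizedUtilityBar u) : IsUtility u := by
  rcases h with h | rfl
  · refine ⟨h.1, 1, fun x => ?_⟩
    rw [abs_of_nonneg (h.2.1.1 ⟨x, rfl⟩)]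
    exact h.2.2.1 ⟨x, rfl⟩
  · exact ⟨measurable_const, 0, by simp⟩

end Lotteries

theorem stmt5 {Ω O I : Type*} [mΩ : MeasurableSpace Ω] [mO : MeasurableSpace O]
    [Fintype I] (hO : 4 ≤ Cardinal.mk O) (hI : 3 ≤ Fintype.card I)
    (Φ : (I → Pref Ω O) → Pref Ω O)
    (hSWF : ∀ p : I → Pref Ω O, IsProfile p → IsSEU (Φ p))
    (hmono : RestrictedMonotonicity Φ)
    (hfaith : Faithful Φ)
    (p : I → Pref Ω O) (hp : IsProfile p)
    (πa : I → Measure Ω) (ua : I → O → ℝ)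
    (hrep : ∀ i, NormRep (πa i) (ua i) (p i))
    (πp : Measure Ω) (up : O → ℝ) (hrepp : NormRep πp up (Φ p)) :
    (∃ w : I → ℝ, UEquiv up (fun x => ∑ i ∈ concerned p, w i * ua i x)) ∧
    (UtilsLinIndep (concerned p) ua →
      ∃ w : I → ℝ, (∀ i ∈ concerned p, 0 < w i) ∧
        UEquiv up (fun x => ∑ i ∈ concerned p, w i * ua i x) ∧
        ∀ w' : I → ℝ, UEquiv up (fun x => ∑ i ∈ concerned p, w' i * ua i x) →
          ∃ c : ℝ, 0 < c ∧ ∀ i ∈ concerned p, w' i = c * w i) := by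
  classical
  have hrep' : ∀ i ∈ concerned p,
      IsBelief (πa i) ∧ IsUtility (ua i) ∧ Represents (πa i) (ua i) (p i) :=
    fun i _ => ⟨(hrep i).1, utility_of_bar _ (hrep i).2.1, (hrep i).2.2⟩
  have hup := utility_of_bar _ hrepp.2.1
  obtain ⟨w, e, hw⟩ := in_span Φ hSWF hmono hfaith πa ua _ p hp rfl hrep' πp up hrepp.1
    hup hrepp.2.2
  have hE : UEquiv up (fun x => ∑ i ∈ concerned p, w i * ua i x) :=
    ⟨1, one_pos, e, fun x => by rw [hw, one_mul]⟩
  refine ⟨⟨w, hE⟩, fun hind => ⟨w, ?_, hE, ?_⟩⟩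
  · intro i hi
    have hp' := isProfile_upd p hp i
    have hc := concerned_upd p i
    obtain ⟨π', u', h', hu', r'⟩ := hSWF _ hp'
    obtain ⟨v, e', hv⟩ := in_span Φ hSWF hmono hfaith πa ua _ (updIndiff p i) hp' rfl (by
      intro j hj
      rw [hc, Finset.mem_erase] at hj
      have := hrep' j hj.2
      simpa [updIndiff, hj.1] using this) π' u' h' hu' r'
    obtain ⟨hbi, hui, ri⟩ := hrep' i hi
    obtain ⟨a, b, d, habd, hd⟩ := one_step Φ hmono p hp i π' (πa i) πp u' (ua i) up h' hbi
      hrepp.1 hu' hui hup r' ri hrepp.2.2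
    have hsum : ∀ (t : I → ℝ) (k s : ℝ) (x : O),
        ∑ j ∈ concerned p, (t j - if j = i then k else s * v j) * ua j x =
        ∑ j ∈ concerned p, t j * ua j x - k * ua i x - s * (u' x - e') := by
      intro t k s x
      have h1 : ∑ j ∈ (concerned p).erase i, (t j - if j = i then k else s * v j) * ua j x =
          ∑ j ∈ (concerned p).erase i, t j * ua j x -
            s * ∑ j ∈ (concerned p).erase i, v j * ua j x := by
        rw [Finset.mul_sum, ← Finset.sum_sub_distrib]
        refine Finset.sum_congr rfl fun j hj => ?_
        rw [if_neg (Finset.mem_erase.1 hj).1]; ring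
      rw [← Finset.add_sum_erase _ _ hi, h1, ← Finset.add_sum_erase _ (fun j => t j * ua j x) hi,
        hv x, hc, if_pos rfl]
      ring
    have hdpos : 0 < d := by
      apply hd
      rintro ⟨a', b', hab⟩
      have := hind (fun j => 0 - if j = i then -1 else b' * v j) ⟨a' + b' * e', fun x => by
        rw [hsum (fun _ => 0), hab x]; simp; ring⟩ i hi
      simp at this
    have := hind (fun j => w j - if j = i then d else b * v j) ⟨a + b * e' - e, fun x => by
      rw [hsum]
      have h1 := hw x
      have h2 := habd x
      linarith⟩ i hi
    simp at this
    linarith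
  · rintro w' ⟨a, ha, b, hab⟩
    refine ⟨a⁻¹, inv_pos.2 ha, fun i hi => ?_⟩
    have := hind (fun j => a * w' j - w j) ⟨e - b, fun x => by
      have h1 := hw x
      have h2 := hab x
      have h3 : ∑ j ∈ concerned p, (a * w' j - w j) * ua j x =
          a * ∑ j ∈ concerned p, w' j * ua j x - ∑ j ∈ concerned p, w j * ua j x := by
        rw [Finset.mul_sum, ← Finset.sum_sub_distrib]
        exact Finset.sum_congr rfl fun j _ => by ring
      rw [h3]
      linarith⟩ i hi
    have h4 : a * w' i = w i := by simpa [sub_eq_zero] using this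
    rw [← h4, inv_mul_cancel_left₀ ha.ne']
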